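/- Let p ≥ 3 and let d_1, …, d_n be a martingale-difference sequence with respect to a filtration F_0 ⊆ F_1 ⊆ ⋯ ⊆ F_n on a probability space (each d_k is F_k-measurable and E[d_k | F_{k-1}] = 0), with each d_k bounded. Define D_k = the F_{k-1}-measurable function whose value on each atom V of F_{k-1} is the essential sup of |d_k| on V (assuming each F_{k-1} is generated by a countable partition into atoms), and 𝔖(d) = (Σ_{k=1}^n D_k²)^{1/2}. Then ‖Σ_{k=1}^n d_k‖_p ≤ ‖(r_1 + ⋯ + r_n)/√n‖_p · ‖𝔖(d)‖_∞, where r_k are independent Rademacher variables, and the constant is sharp (equality holds for d_k = r_k/√n). -/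

import Mathlib

open MeasureTheory

lemma ConvexOn.add_symm_le {s : Set ℝ} {F : ℝ → ℝ} (hF : ConvexOn ℝ s F) {m u v : ℝ}
    (hu : 0 ≤ u) (huv : u ≤ v) (h₁ : m + v ∈ s) (h₂ : m - v ∈ s) :
    F (m + u) + F (m - u) ≤ F (m + v) + F (m - v) := by
  rcases hu.eq_or_lt with rfl | hu
  · have := hF.2 h₁ h₂ (by norm_num : (0 : ℝ) ≤ 1 / 2) (by norm_num : (0 : ℝ) ≤ 1 / 2)
      (by norm_num)
    simp only [smul_eq_mul] at this
    rw [show (1 / 2 : ℝ) * (m + v) + 1 / 2 * (m - v) = m by ring] at this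
    simp only [add_zero, sub_zero]
    linarith
  have hv : 0 < v := hu.trans_le huv
  have ha : 0 ≤ (v + u) / (2 * v) := by positivity
  have hb : 0 ≤ (v - u) / (2 * v) := div_nonneg (by linarith) (by positivity)
  have hab : (v + u) / (2 * v) + (v - u) / (2 * v) = 1 := by field_simp; ring
  have k₁ := hF.2 h₁ h₂ ha hb hab
  have k₂ := hF.2 h₁ h₂ hb ha (by rw [add_comm]; exact hab)
  simp only [smul_eq_mul] at k₁ k₂
  rw [show (v + u) / (2 * v) * (m + v) + (v - u) / (2 * v) * (m - v) = m + u by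
    field_simp; ring] at k₁
  rw [show (v - u) / (2 * v) * (m + v) + (v + u) / (2 * v) * (m - v) = m - u by
    field_simp; ring] at k₂
  calc F (m + u) + F (m - u)
      ≤ ((v + u) / (2 * v) + (v - u) / (2 * v)) * (F (m + v) + F (m - v)) := by linarith
    _ = _ := by rw [hab, one_mul]

lemma convexOn_abs_rpow {q : ℝ} (hq : 1 ≤ q) : ConvexOn ℝ Set.univ fun y : ℝ => |y| ^ q := by
  refine ⟨convex_univ, fun x _ y _ a b ha hb hab => ?_⟩
  refine le_trans ?_ ((convexOn_rpow hq).2 (abs_nonneg x) (abs_nonneg y) ha hb hab)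
  refine Real.rpow_le_rpow (abs_nonneg _) ?_ (by linarith)
  simp only [smul_eq_mul]
  refine (abs_add_le _ _).trans ?_
  rw [abs_mul, abs_mul, abs_of_nonneg ha, abs_of_nonneg hb]

lemma hasDerivAt_abs_rpow_mul_self {q : ℝ} (hq : 0 < q) (y : ℝ) :
    HasDerivAt (fun y : ℝ => |y| ^ q * y) ((q + 1) * |y| ^ q) y := by
  rcases eq_or_ne y 0 with rfl | hy
  · rw [hasDerivAt_iff_tendsto_slope_zero]
    have h : Filter.Tendsto (fun t : ℝ => |t| ^ q) (nhdsWithin 0 {0}ᶜ) (nhds (|0| ^ q)) := by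
      refine Filter.Tendsto.mono_left ?_ nhdsWithin_le_nhds
      exact ((continuous_abs.rpow_const fun _ => Or.inr hq.le).tendsto 0)
    simp only [abs_zero, Real.zero_rpow hq.ne', mul_zero] at h ⊢
    refine h.congr' ?_
    filter_upwards [self_mem_nhdsWithin] with t ht
    have ht : t ≠ 0 := ht
    simp only [zero_add, smul_eq_mul, sub_zero]
    field_simp
  · have h := ((hasDerivAt_abs hy).rpow_const (p := q) (Or.inl (abs_ne_zero.2 hy))).mul
      (hasDerivAt_id y)
    refine h.congr_deriv ?_
    have e : |y| ^ q = |y| ^ (q - 1) * |y| := by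
      rw [← Real.rpow_add_one (abs_ne_zero.2 hy)]; congr 1; ring
    have e' : (SignType.sign y : ℝ) * y = |y| := by rw [mul_comm]; exact self_mul_sign y
    simp only [id, mul_one]
    rw [e]
    linear_combination (q * |y| ^ (q - 1)) * e'

lemma monotoneOn_abs_rpow_diff_div {q : ℝ} (hq : 1 ≤ q) (x : ℝ) :
    MonotoneOn (fun u : ℝ => (|x + u| ^ q * (x + u) - |x - u| ^ q * (x - u)) / u)
      (Set.Ioi 0) := by
  set k : ℝ → ℝ := fun u => |x + u| ^ q * (x + u) - |x - u| ^ q * (x - u) with hk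
  have hder (u : ℝ) : HasDerivAt k ((q + 1) * (|x + u| ^ q + |x - u| ^ q)) u := by
    have h₁ := (hasDerivAt_abs_rpow_mul_self (by linarith : 0 < q) (x + u)).comp u
      ((hasDerivAt_id u).const_add x)
    have h₂ := (hasDerivAt_abs_rpow_mul_self (by linarith : 0 < q) (x - u)).comp u
      ((hasDerivAt_id u).const_sub x)
    exact (h₁.sub h₂).congr_deriv (by ring)
  have hconv : ConvexOn ℝ (Set.Ici 0) k := by
    refine MonotoneOn.convexOn_of_deriv (convex_Ici 0)
      (fun u _ => (hder u).continuousAt.continuousWithinAt)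
      (fun u _ => (hder u).differentiableAt.differentiableWithinAt) ?_
    intro u hu v hv huv
    rw [interior_Ici, Set.mem_Ioi] at hu
    rw [(hder u).deriv, (hder v).deriv]
    exact mul_le_mul_of_nonneg_left ((convexOn_abs_rpow hq).add_symm_le hu.le huv trivial trivial)
      (by linarith)
  intro u hu v hv huv
  have hu : 0 < u := hu
  have hv : 0 < v := hv
  have h := hconv.2 (Set.mem_Ici.2 hv.le) (Set.mem_Ici.2 le_rfl)
    (div_nonneg hu.le hv.le) (sub_nonneg.2 ((div_le_one hv).2 huv)) (add_sub_cancel _ _)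
  have h0 : k 0 = 0 := by simp [hk]
  simp only [smul_eq_mul, mul_zero, add_zero, h0, div_mul_cancel₀ _ hv.ne'] at h
  change k u / u ≤ k v / v
  rw [div_le_iff₀ hu]
  calc k u ≤ u / v * k v := h
    _ = _ := by ring

lemma convexOn_abs_rpow_sqrt {p : ℝ} (hp : 3 ≤ p) (x : ℝ) :
    ConvexOn ℝ (Set.Ici 0) fun t : ℝ => |x + √t| ^ p + |x - √t| ^ p := by
  have hder (t : ℝ) (ht : 0 < t) : HasDerivAt (fun t : ℝ => |x + √t| ^ p + |x - √t| ^ p)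
      (p / 2 * ((|x + √t| ^ (p - 2) * (x + √t) - |x - √t| ^ (p - 2) * (x - √t)) / √t)) t := by
    have hs := Real.hasDerivAt_sqrt ht.ne'
    have h₁ := (hasDerivAt_abs_rpow (x + √t) (by linarith : 1 < p)).comp t (hs.const_add x)
    have h₂ := (hasDerivAt_abs_rpow (x - √t) (by linarith : 1 < p)).comp t (hs.const_sub x)
    have : √t ≠ 0 := (Real.sqrt_pos.2 ht).ne'
    exact (h₁.add h₂).congr_deriv (by field_simp; ring)
  refine MonotoneOn.convexOn_of_deriv (convex_Ici 0) ?_ ?_ ?_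
  · have hp0 : 0 ≤ p := by linarith
    exact Continuous.continuousOn
      (((continuous_const.add Real.continuous_sqrt).abs.rpow_const fun _ => Or.inr hp0).add
        ((continuous_const.sub Real.continuous_sqrt).abs.rpow_const fun _ => Or.inr hp0))
  · rw [interior_Ici]
    exact fun t ht => (hder t ht).differentiableAt.differentiableWithinAt
  · rw [interior_Ici]
    intro s hs t ht hst
    rw [(hder s hs).deriv, (hder t ht).deriv]
    exact mul_le_mul_of_nonneg_left (monotoneOn_abs_rpow_diff_div (by linarith : 1 ≤ p - 2) x
      (Real.sqrt_pos.2 hs) (Real.sqrt_pos.2 ht) (Real.sqrt_le_sqrt hst)) (by linarith)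

/-- The average of `f` over the two points `x ± a`. -/
noncomputable def signAverage (a : ℝ) (f : ℝ → ℝ) (x : ℝ) : ℝ := (f (x + a) + f (x - a)) / 2

lemma signAverage_mono (a : ℝ) : Monotone (signAverage a) := fun f g h x => by
  have h₁ := h (x + a)
  have h₂ := h (x - a)
  unfold signAverage
  linarith

lemma signAverage_commute (a b : ℝ) : Function.Commute (signAverage a) (signAverage b) := by
  intro f
  ext x
  simp only [signAverage]
  rw [show x + b - a = x - a + b by ring, show x - b - a = x - a - b by ring,
    show x + b + a = x + a + b by ring, show x - b + a = x + a - b by ring]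
  ring

lemma ConvexOn.signAverage {f : ℝ → ℝ} (hf : ConvexOn ℝ Set.univ f) (a : ℝ) :
    ConvexOn ℝ Set.univ (signAverage a f) := by
  refine ⟨convex_univ, fun x _ y _ s t hs ht hst => ?_⟩
  have h₁ := hf.2 (Set.mem_univ (x + a)) (Set.mem_univ (y + a)) hs ht hst
  have h₂ := hf.2 (Set.mem_univ (x - a)) (Set.mem_univ (y - a)) hs ht hst
  simp only [_root_.signAverage, smul_eq_mul] at *
  rw [show s * (x + a) + t * (y + a) = s * x + t * y + a by linear_combination a * hst] at h₁
  rw [show s * (x - a) + t * (y - a) = s * x + t * y - a by linear_combination -a * hst] at h₂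
  linarith

lemma ConvexOn.signAverage_iterate {f : ℝ → ℝ} (hf : ConvexOn ℝ Set.univ f) (a : ℝ) (m : ℕ) :
    ConvexOn ℝ Set.univ ((_root_.signAverage a)^[m] f) := by
  induction m with
  | zero => exact hf
  | succ m ih => rw [Function.iterate_succ_apply']; exact ih.signAverage a

lemma signAverage_iterate_abs_rpow_mem_Icc {p : ℝ} (hp : 0 ≤ p) {a : ℝ} (ha : 0 ≤ a) (m : ℕ)
    (x : ℝ) :
    (signAverage a)^[m] (fun y => |y| ^ p) x ∈ Set.Icc 0 ((|x| + m * a) ^ p) := by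
  induction m generalizing x with
  | zero => simp [Real.rpow_nonneg]
  | succ m ih =>
    rw [Function.iterate_succ_apply']
    obtain ⟨l₁, u₁⟩ := ih (x + a)
    obtain ⟨l₂, u₂⟩ := ih (x - a)
    have hb : ∀ y : ℝ, |y| ≤ |x| + a →
        (|y| + m * a) ^ p ≤ (|x| + (m + 1 : ℕ) * a) ^ p := fun y hy => by
      refine Real.rpow_le_rpow (by positivity) ?_ hp
      push_cast
      linarith
    have b₁ := hb (x + a) ((abs_add_le _ _).trans (by rw [abs_of_nonneg ha]))
    have b₂ := hb (x - a) ((abs_sub _ _).trans (by rw [abs_of_nonneg ha]))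
    simp only [signAverage, Set.mem_Icc]
    constructor <;> linarith

lemma signAverage_iterate_eq_sum (a : ℝ) (f : ℝ → ℝ) (m : ℕ) (x : ℝ) :
    (signAverage a)^[m] f x =
      (1 / 2 ^ m : ℝ) * ∑ ε : Fin m → Bool, f (x + ∑ k, (if ε k then (1 : ℝ) else -1) * a) := by
  induction m generalizing x with
  | zero => simp
  | succ m ih =>
    rw [Function.iterate_succ_apply', signAverage, ih, ih,
      ← (Fin.consEquiv fun _ : Fin (m + 1) => Bool).sum_comp, Fintype.sum_prod_type]
    simp only [Fin.consEquiv_apply, Fin.sum_univ_succ, Fin.cons_zero, Fin.cons_succ,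
      Fintype.sum_bool, if_true, Bool.false_eq_true, if_false, one_mul, neg_mul, ← add_assoc,
      ← sub_eq_add_neg, pow_succ]
    field_simp

lemma signAverage_signAverage_abs_rpow_le {p : ℝ} (hp : 3 ≤ p) {a b c d : ℝ}
    (hab : 0 ≤ a * b) (hsq : a ^ 2 + b ^ 2 = c ^ 2 + d ^ 2) (hle : a * b ≤ c * d) :
    signAverage a (signAverage b fun y => |y| ^ p) ≤
      signAverage c (signAverage d fun y => |y| ^ p) := by
  intro x
  have key (a b : ℝ) : signAverage a (signAverage b fun y => |y| ^ p) x =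
      ((|x + √(a ^ 2 + b ^ 2 + 2 * (a * b))| ^ p + |x - √(a ^ 2 + b ^ 2 + 2 * (a * b))| ^ p) +
        (|x + √(a ^ 2 + b ^ 2 - 2 * (a * b))| ^ p +
          |x - √(a ^ 2 + b ^ 2 - 2 * (a * b))| ^ p)) / 4 := by
    have habs (z : ℝ) : |x + abs z| ^ p + |x - abs z| ^ p = |x + z| ^ p + |x - z| ^ p := by
      rcases abs_choice z with h | h <;> rw [h]
      rw [sub_neg_eq_add, ← sub_eq_add_neg, add_comm]
    rw [show a ^ 2 + b ^ 2 + 2 * (a * b) = (a + b) ^ 2 by ring,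
      show a ^ 2 + b ^ 2 - 2 * (a * b) = (a - b) ^ 2 by ring, Real.sqrt_sq_eq_abs,
      Real.sqrt_sq_eq_abs, habs, habs]
    simp only [signAverage]
    rw [show x + (a + b) = x + a + b by ring, show x - (a + b) = x - a - b by ring,
      show x + (a - b) = x + a - b by ring, show x - (a - b) = x - a + b by ring]
    ring
  rw [key, key, hsq]
  refine div_le_div_of_nonneg_right ?_ (by norm_num)
  refine (convexOn_abs_rpow_sqrt hp x).add_symm_le (by linarith) (by linarith) ?_ ?_
  · rw [Set.mem_Ici]; nlinarith [sq_nonneg c, sq_nonneg d]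
  · rw [Set.mem_Ici]; nlinarith [sq_nonneg (c - d)]

lemma signAverage_iterate_abs_rpow_le {p : ℝ} (hp : 3 ≤ p) (m : ℕ) {α c q : ℝ} (hα : 0 ≤ α)
    (hc : 0 ≤ c) (hq : α + m * c = (m + 1) * q) :
    signAverage √α ((signAverage √c)^[m] fun y => |y| ^ p) ≤
      (signAverage √q)^[m + 1] fun y => |y| ^ p := by
  induction m generalizing α with
  | zero =>
    obtain rfl : α = q := by simpa using hq
    exact le_rfl
  | succ m ih =>
    push_cast at hq
    have hm : (0 : ℝ) ≤ m := m.cast_nonneg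
    have hq0 : 0 ≤ q := by
      have : 0 ≤ ((m : ℝ) + 1 + 1) * q := by rw [← hq]; positivity
      exact nonneg_of_mul_nonneg_right this (by positivity)
    have hprod : 0 ≤ (α - q) * (q - c) := by
      have : α - q = (m + 1) * (q - c) := by linarith
      rw [this]
      nlinarith [mul_nonneg hm (sq_nonneg (q - c)), sq_nonneg (q - c)]
    have hβ : 0 ≤ α + c - q := by
      by_contra! h
      nlinarith
    have hstep : signAverage √α (signAverage √c fun y => |y| ^ p) ≤
        signAverage √q (signAverage √(α + c - q) fun y => |y| ^ p) := by
      refine signAverage_signAverage_abs_rpow_le hp (by positivity) ?_ ?_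
      · rw [Real.sq_sqrt hα, Real.sq_sqrt hc, Real.sq_sqrt hq0, Real.sq_sqrt hβ]; ring
      · rw [← Real.sqrt_mul hα, ← Real.sqrt_mul hq0]
        exact Real.sqrt_le_sqrt (by linarith)
    calc signAverage √α ((signAverage √c)^[m + 1] fun y => |y| ^ p)
        = (signAverage √c)^[m] (signAverage √α (signAverage √c fun y => |y| ^ p)) := by
          rw [Function.iterate_succ_apply]
          exact ((signAverage_commute _ _).iterate_right m) _
      _ ≤ (signAverage √c)^[m] (signAverage √q (signAverage √(α + c - q) fun y => |y| ^ p)) :=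
          (signAverage_mono _).iterate m hstep
      _ = signAverage √q (signAverage √(α + c - q) ((signAverage √c)^[m] fun y => |y| ^ p)) := by
          rw [← ((signAverage_commute √q _).iterate_right m).eq,
            ← ((signAverage_commute √(α + c - q) _).iterate_right m).eq]
      _ ≤ signAverage √q ((signAverage √q)^[m + 1] fun y => |y| ^ p) :=
          signAverage_mono _ (ih hβ (by linarith))
      _ = (signAverage √q)^[m + 1 + 1] fun y => |y| ^ p := by
          rw [Function.iterate_succ_apply' _ (m + 1)]

/-- The `p`-th moment of `x + √(s / m) * (r₁ + ⋯ + rₘ)`, with `rᵢ` independent Rademacher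
variables. -/
noncomputable def rademacherMoment (p : ℝ) (m : ℕ) (s x : ℝ) : ℝ :=
  (signAverage √(s / m))^[m] (fun y => |y| ^ p) x

lemma signAverage_rademacherMoment_le {p : ℝ} (hp : 3 ≤ p) (m : ℕ) {a s : ℝ} (ha : 0 ≤ a)
    (has : a ^ 2 ≤ s) (x : ℝ) :
    signAverage a (rademacherMoment p m (s - a ^ 2)) x ≤ rademacherMoment p (m + 1) s x := by
  rcases m.eq_zero_or_pos with rfl | hm
  · have h := (convexOn_abs_rpow (by linarith : 1 ≤ p)).add_symm_le (m := x) ha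
      (Real.le_sqrt_of_sq_le has) trivial trivial
    simp only [rademacherMoment, signAverage, Function.iterate_zero, id, zero_add,
      Function.iterate_one, Nat.cast_one, div_one]
    linarith
  · have hm' : (0 : ℝ) < m := Nat.cast_pos.2 hm
    have h := signAverage_iterate_abs_rpow_le hp m (α := a ^ 2) (c := (s - a ^ 2) / m)
      (q := s / (m + 1 : ℕ)) (sq_nonneg a) (div_nonneg (by linarith) hm'.le)
      (by push_cast; field_simp; ring) x
    rw [Real.sqrt_sq ha] at h
    exact h

lemma setIntegral_le_signAverage {Ω : Type*} [MeasurableSpace Ω] {μ : Measure Ω}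
    [IsFiniteMeasure μ] {V : Set Ω} (hV : MeasurableSet V) {g : ℝ → ℝ}
    (hg : ConvexOn ℝ Set.univ g) (hg0 : ∀ x, 0 ≤ g x) {d : Ω → ℝ} (hd : Measurable d) {a : ℝ}
    (hda : ∀ y ∈ V, |d y| ≤ a) (hint : ∫ y in V, d y ∂μ = 0) (x : ℝ) :
    ∫ y in V, g (x + d y) ∂μ ≤ ∫ _ in V, signAverage a g x ∂μ := by
  rcases V.eq_empty_or_nonempty with rfl | ⟨y₀, hy₀⟩
  · simp
  have ha : 0 ≤ a := (abs_nonneg _).trans (hda y₀ hy₀)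
  set b : ℝ := (g (x + a) - g (x - a)) / (2 * a) with hb
  have hdi : Integrable d (μ.restrict V) := Integrable.of_bound hd.aestronglyMeasurable a
    ((ae_restrict_iff' hV).2 (Filter.Eventually.of_forall hda))
  calc ∫ y in V, g (x + d y) ∂μ ≤ ∫ y in V, (signAverage a g x + b * d y) ∂μ := by
        refine integral_mono_of_nonneg (Filter.Eventually.of_forall fun y => hg0 _)
          ((integrable_const _).add (hdi.const_mul b)) ?_
        refine (ae_restrict_iff' hV).2 (Filter.Eventually.of_forall fun y hy => ?_)
        have hy := abs_le.1 (hda y hy)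
        rcases ha.eq_or_lt with rfl | ha
        · have : d y = 0 := by linarith [hy.1, hy.2]
          simp [this, signAverage]
        · have h := hg.2 (Set.mem_univ (x + a)) (Set.mem_univ (x - a))
            (div_nonneg (by linarith : 0 ≤ a + d y) (by linarith : 0 ≤ 2 * a))
            (div_nonneg (by linarith : 0 ≤ a - d y) (by linarith : 0 ≤ 2 * a))
            (by field_simp; ring)
          simp only [smul_eq_mul] at h
          rw [show (a + d y) / (2 * a) * (x + a) + (a - d y) / (2 * a) * (x - a) = x + d y by
            field_simp; ring] at h
          refine h.trans (le_of_eq ?_)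
          simp only [hb, signAverage]
          field_simp
          ring
    _ = _ := by
        rw [integral_add (integrable_const _) (hdi.const_mul b), integral_const_mul, hint,
          mul_zero, add_zero]

lemma measurable_rademacherMoment {Ω : Type*} [MeasurableSpace Ω] (p : ℝ) (m : ℕ) {s S : Ω → ℝ}
    (hs : Measurable s) (hS : Measurable S) :
    Measurable fun x => rademacherMoment p m (s x) (S x) := by
  simp only [rademacherMoment, signAverage_iterate_eq_sum, ← Finset.sum_mul]
  fun_prop

lemma integrable_rademacherMoment {Ω : Type*} [MeasurableSpace Ω] {μ : Measure Ω}
    [IsFiniteMeasure μ] {p : ℝ} (hp : 0 ≤ p) (m : ℕ) {s S : Ω → ℝ} (hs : Measurable s)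
    (hS : Measurable S) {N C : ℝ} (hsN : ∀ x, s x ≤ N) (hSC : ∀ x, |S x| ≤ C) :
    Integrable (fun x => rademacherMoment p m (s x) (S x)) μ := by
  refine Integrable.of_bound (measurable_rademacherMoment p m hs hS).aestronglyMeasurable
    ((C + m * √(N / m)) ^ p) (Filter.Eventually.of_forall fun x => ?_)
  obtain ⟨h₀, h₁⟩ := signAverage_iterate_abs_rpow_mem_Icc hp (Real.sqrt_nonneg (s x / m)) m (S x)
  rw [rademacherMoment, Real.norm_eq_abs, abs_of_nonneg h₀]
  refine h₁.trans (Real.rpow_le_rpow (by positivity) ?_ hp)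
  have h := Real.sqrt_le_sqrt (div_le_div_of_nonneg_right (hsN x) (m.cast_nonneg : (0 : ℝ) ≤ m))
  exact add_le_add (hSC x) (mul_le_mul_of_nonneg_left h m.cast_nonneg)

lemma measurable_of_eq_on_fibers {Ω : Type*} [MeasurableSpace Ω] {e : Ω → ℕ} (he : Measurable e)
    {f : Ω → ℝ} (hf : ∀ x y, e x = e y → f x = f y) : Measurable f := by
  have h : f = Function.extend e f 0 ∘ e := by
    ext x
    exact (Function.FactorsThrough.extend_apply (fun x y h => hf x y h) 0 x).symm
  rw [h]
  exact (measurable_of_countable _).comp he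

lemma integral_rademacherMoment_add_le {Ω : Type*} [MeasurableSpace Ω] {μ : Measure Ω}
    [IsFiniteMeasure μ] {p : ℝ} (hp : 3 ≤ p) (m : ℕ) {e : Ω → ℕ} (he : Measurable e)
    {S D s d : Ω → ℝ} (hS : ∀ x y, e x = e y → S x = S y) (hD : ∀ x y, e x = e y → D x = D y)
    (hs : ∀ x y, e x = e y → s x = s y) (hd : Measurable d) (hdD : ∀ x, |d x| ≤ D x)
    (hint : ∀ i, ∫ x in e ⁻¹' {i}, d x ∂μ = 0) (hDs : ∀ᵐ x ∂μ, D x ^ 2 ≤ s x)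
    {C C' N : ℝ} (hSC : ∀ x, |S x| ≤ C) (hdC : ∀ x, |d x| ≤ C') (hsN : ∀ x, s x ≤ N) :
    ∫ x, rademacherMoment p m (s x - D x ^ 2) (S x + d x) ∂μ ≤
      ∫ x, rademacherMoment p (m + 1) (s x) (S x) ∂μ := by
  have hp0 : 0 ≤ p := by linarith
  have hSm := measurable_of_eq_on_fibers he hS
  have hDm := measurable_of_eq_on_fibers he hD
  have hsm := measurable_of_eq_on_fibers he hs
  have hfib (i : ℕ) : MeasurableSet (e ⁻¹' {i}) := he (measurableSet_singleton i)
  have hdisj : Pairwise (Function.onFun Disjoint fun i => e ⁻¹' {i}) := fun i j hij =>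
    Disjoint.preimage e (Set.disjoint_singleton.2 hij)
  have hcover : ⋃ i, e ⁻¹' {i} = Set.univ :=
    Set.eq_univ_of_forall fun x => Set.mem_iUnion.2 ⟨e x, rfl⟩
  have hi₁ : Integrable (fun x => rademacherMoment p m (s x - D x ^ 2) (S x + d x)) μ :=
    integrable_rademacherMoment hp0 m (hsm.sub (hDm.pow_const 2)) (hSm.add hd)
      (fun x => (sub_le_self _ (sq_nonneg _)).trans (hsN x))
      (fun x => (abs_add_le _ _).trans (add_le_add (hSC x) (hdC x)))
  have hi₂ : Integrable (fun x => rademacherMoment p (m + 1) (s x) (S x)) μ :=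
    integrable_rademacherMoment hp0 (m + 1) hsm hSm hsN hSC
  have h₁ := hasSum_integral_iUnion hfib hdisj hi₁.integrableOn
  have h₂ := hasSum_integral_iUnion hfib hdisj hi₂.integrableOn
  rw [hcover, setIntegral_univ] at h₁ h₂
  refine hasSum_le (fun i => ?_) h₁ h₂
  rcases eq_or_ne (μ (e ⁻¹' {i})) 0 with h0 | h0
  · rw [setIntegral_measure_zero _ h0, setIntegral_measure_zero _ h0]
  obtain ⟨x₀, hx₀, hx₀s⟩ : ∃ x₀, e x₀ = i ∧ D x₀ ^ 2 ≤ s x₀ := by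
    by_contra! h
    exact h0 (measure_mono_null (fun x hx => (h x hx).not_ge) (ae_iff.1 hDs))
  have hD0 : 0 ≤ D x₀ := (abs_nonneg _).trans (hdD x₀)
  have heq {x : Ω} (hx : x ∈ e ⁻¹' {i}) : e x = e x₀ := Eq.trans hx hx₀.symm
  calc ∫ x in e ⁻¹' {i}, rademacherMoment p m (s x - D x ^ 2) (S x + d x) ∂μ
      = ∫ x in e ⁻¹' {i}, rademacherMoment p m (s x₀ - D x₀ ^ 2) (S x₀ + d x) ∂μ :=
        setIntegral_congr_fun (hfib i) fun x hx => by
          simp only [hS x x₀ (heq hx), hD x x₀ (heq hx), hs x x₀ (heq hx)]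
    _ ≤ ∫ _ in e ⁻¹' {i}, signAverage (D x₀) (rademacherMoment p m (s x₀ - D x₀ ^ 2)) (S x₀) ∂μ :=
        setIntegral_le_signAverage (hfib i)
          ((convexOn_abs_rpow (by linarith)).signAverage_iterate _ _)
          (fun x => (signAverage_iterate_abs_rpow_mem_Icc hp0 (Real.sqrt_nonneg _) m x).1) hd
          (fun y hy => (hdD y).trans (hD y x₀ (heq hy)).le) (hint i) _
    _ ≤ ∫ _ in e ⁻¹' {i}, rademacherMoment p (m + 1) (s x₀) (S x₀) ∂μ :=
        setIntegral_mono (integrable_const _) (integrable_const _) fun _ =>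
          signAverage_rademacherMoment_le hp m hD0 hx₀s _
    _ = ∫ x in e ⁻¹' {i}, rademacherMoment p (m + 1) (s x) (S x) ∂μ :=
        setIntegral_congr_fun (hfib i) fun x hx => by
          simp only [hS x x₀ (heq hx), hs x x₀ (heq hx)]

lemma integral_abs_sum_rpow_le_rademacherMoment {Ω : Type*} [MeasurableSpace Ω] {μ : Measure Ω}
    [IsProbabilityMeasure μ] (n : ℕ) {p : ℝ} (hp : 3 ≤ p) {e : ℕ → Ω → ℕ}
    (he : ∀ k, Measurable (e k)) (href : ∀ k x y, e (k + 1) x = e (k + 1) y → e k x = e k y)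
    {d : ℕ → Ω → ℝ} (hd : ∀ k, Measurable (d k)) (hbdd : ∀ k, ∃ C : ℝ, ∀ x, |d k x| ≤ C)
    (hadapt : ∀ k x y, e (k + 1) x = e (k + 1) y → d k x = d k y)
    (hint : ∀ k i, ∫ x in e k ⁻¹' {i}, d k x ∂μ = 0) {N : ℝ}
    (hsq : ∀ᵐ x ∂μ, ∑ k ∈ Finset.range n,
      sSup ((fun y => |d k y|) '' (e k ⁻¹' {e k x})) ^ 2 ≤ N) :
    ∫ x, |∑ k ∈ Finset.range n, d k x| ^ p ∂μ ≤ rademacherMoment p n N 0 := by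
  set D : ℕ → Ω → ℝ := fun k x => sSup ((fun y => |d k y|) '' (e k ⁻¹' {e k x})) with hD
  set S : ℕ → Ω → ℝ := fun k x => ∑ j ∈ Finset.range k, d j x with hS
  set s : ℕ → Ω → ℝ := fun k x => N - ∑ j ∈ Finset.range k, D j x ^ 2 with hs
  have hmono {j k : ℕ} (hjk : j ≤ k) (x y : Ω) (h : e k x = e k y) : e j x = e j y := by
    induction k, hjk using Nat.le_induction with
    | base => exact h
    | succ k _ ih => exact ih (href k x y h)
  have hDe (k : ℕ) (x y : Ω) (h : e k x = e k y) : D k x = D k y := by simp only [hD, h]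
  have hSe (k : ℕ) (x y : Ω) (h : e k x = e k y) : S k x = S k y :=
    Finset.sum_congr rfl fun j hj => hadapt j x y (hmono (Finset.mem_range.1 hj) x y h)
  have hse (k : ℕ) (x y : Ω) (h : e k x = e k y) : s k x = s k y := by
    refine congrArg (N - ·) (Finset.sum_congr rfl fun j hj => ?_)
    rw [hDe j x y (hmono (Finset.mem_range.1 hj).le x y h)]
  have hdD (k : ℕ) (x : Ω) : |d k x| ≤ D k x := by
    obtain ⟨C, hC⟩ := hbdd k
    exact le_csSup ⟨C, by rintro _ ⟨y, -, rfl⟩; exact hC y⟩ ⟨x, rfl, rfl⟩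
  have hSb (k : ℕ) : ∃ C, ∀ x, |S k x| ≤ C := by
    choose C hC using hbdd
    exact ⟨∑ j ∈ Finset.range k, C j, fun x =>
      (Finset.abs_sum_le_sum_abs _ _).trans (Finset.sum_le_sum fun j _ => hC j x)⟩
  have hsN (k : ℕ) (x : Ω) : s k x ≤ N :=
    sub_le_self _ (Finset.sum_nonneg fun j _ => sq_nonneg _)
  have key (k : ℕ) (hk : k ≤ n) :
      ∫ x, rademacherMoment p (n - k) (s k x) (S k x) ∂μ ≤ rademacherMoment p n N 0 := by
    induction k with
    | zero => simp [hs, hS]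
    | succ k ih =>
      refine le_trans ?_ (ih (by omega))
      obtain ⟨C, hC⟩ := hSb k
      obtain ⟨C', hC'⟩ := hbdd k
      have hDs : ∀ᵐ x ∂μ, D k x ^ 2 ≤ s k x := by
        filter_upwards [hsq] with x hx
        have h : ∑ j ∈ Finset.range (k + 1), D j x ^ 2 ≤ ∑ j ∈ Finset.range n, D j x ^ 2 :=
          Finset.sum_le_sum_of_subset_of_nonneg (Finset.range_mono hk) fun _ _ _ => sq_nonneg _
        rw [Finset.sum_range_succ] at h
        simp only [hs]
        linarith
      have h := integral_rademacherMoment_add_le hp (n - (k + 1)) (he k) (hSe k) (hDe k) (hse k)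
        (hd k) (hdD k) (hint k) hDs hC hC' (hsN k)
      rw [show n - (k + 1) + 1 = n - k by omega] at h
      simpa only [hS, hs, Finset.sum_range_succ, sub_add_eq_sub_sub] using h
  simpa [rademacherMoment] using key n le_rfl

/-- Sharp Khintchine-type inequality for discrete martingale differences.
`d_1, …, d_n` is a martingale-difference sequence with respect to a filtration
generated by countable partitions `part k` (with `part 0 = {X}`, each atom of
`part (k+1)` contained in an atom of `part k`); each `d_k` is constant on the atoms
of the `k`-th partition and has zero integral over each atom of the `(k-1)`-st
partition.  If a.e. the Chang–Wilson–Wolff square function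
`𝔖(d)(x)² = Σ_k (sup_{V_{k-1}(x)} |d_k|)²` is at most `M²`, then
`‖Σ d_k‖_p ≤ ‖(r_1 + ⋯ + r_n)/√n‖_p · M` for `p ≥ 3`; moreover the constant is
sharp: equality holds for `d_k = r_k/√n` (on the uniform space of sign sequences,
whose square function is identically `1`). -/
theorem stmt_13
    {Ω : Type*} [MeasurableSpace Ω] (μ : Measure Ω) [IsProbabilityMeasure μ]
    (n : ℕ) (hn : 0 < n) (p : ℝ) (hp : 3 ≤ p)
    (part : ℕ → ℕ → Set Ω)
    (hpart_meas : ∀ k i, MeasurableSet (part k i))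
    (hpart_disj : ∀ k, Pairwise fun i j => Disjoint (part k i) (part k j))
    (hpart_cover : ∀ k, (⋃ i, part k i) = Set.univ)
    (hpart_zero : part 0 0 = Set.univ)
    (hpart_refine : ∀ k i, ∃ j, part (k + 1) i ⊆ part k j)
    (d : Fin n → Ω → ℝ)
    (hd_meas : ∀ k, Measurable (d k))
    (hd_bdd : ∀ k, ∃ C : ℝ, ∀ x, |d k x| ≤ C)
    (hd_adapted : ∀ (k : Fin n) (i : ℕ), ∀ x ∈ part (k.1 + 1) i, ∀ y ∈ part (k.1 + 1) i,
      d k x = d k y)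
    (hd_mart : ∀ (k : Fin n) (i : ℕ), ∫ x in part k.1 i, d k x ∂μ = 0)
    (M : ℝ) (hM : 0 < M)
    (hSq : ∀ᵐ x ∂μ, ∀ i : ℕ → ℕ, (∀ k : Fin n, x ∈ part k.1 (i k.1)) →
      ∑ k : Fin n, (sSup ((fun y => |d k y|) '' part k.1 (i k.1))) ^ 2 ≤ M ^ 2) :
    (∫ x, |∑ k, d k x| ^ p ∂μ) ^ (1 / p) ≤
      ((1 / 2 ^ n : ℝ) *
          ∑ ε : Fin n → Bool,
            |∑ k, (if ε k then (1 : ℝ) else -1) / Real.sqrt n| ^ p) ^ (1 / p) * M ∧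
    (∫ x : Fin n → Bool,
          |∑ k, (if x k then (1 : ℝ) else -1) / Real.sqrt n| ^ p
          ∂((PMF.uniformOfFintype (Fin n → Bool)).toMeasure)) ^ (1 / p) =
      ((1 / 2 ^ n : ℝ) *
          ∑ ε : Fin n → Bool,
            |∑ k, (if ε k then (1 : ℝ) else -1) / Real.sqrt n| ^ p) ^ (1 / p) * 1 := by
  have hp0 : 0 < p := by linarith
  constructor
  · choose e he using fun k x => Set.mem_iUnion.1 ((hpart_cover k).symm ▸ Set.mem_univ x)
    have hmem {k i : ℕ} {x : Ω} (hx : x ∈ part k i) : e k x = i := by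
      by_contra h
      exact Set.disjoint_left.1 (hpart_disj k h) (he k x) hx
    have hfib (k i : ℕ) : e k ⁻¹' {i} = part k i :=
      Set.ext fun x => ⟨fun h => h ▸ he k x, hmem⟩
    have hem (k : ℕ) : Measurable (e k) :=
      measurable_to_countable' fun i => hfib k i ▸ hpart_meas k i
    have href (k : ℕ) (x y : Ω) (h : e (k + 1) x = e (k + 1) y) : e k x = e k y := by
      obtain ⟨j, hj⟩ := hpart_refine k (e (k + 1) x)
      rw [hmem (hj (he (k + 1) x)), hmem (hj (h ▸ he (k + 1) y))]
    set d' : ℕ → Ω → ℝ := fun k x => if h : k < n then d ⟨k, h⟩ x else 0 with hd'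
    have hd'_lt {k : ℕ} (h : k < n) : d' k = d ⟨k, h⟩ := by ext x; simp [hd', h]
    have hd'_ge {k : ℕ} (h : ¬ k < n) : d' k = 0 := by ext x; simp [hd', h]
    have hmain := integral_abs_sum_rpow_le_rademacherMoment (μ := μ) n hp (d := d') (N := M ^ 2)
      hem href ?_ ?_ ?_ ?_ ?_
    · have hsum (x : Ω) : ∑ k ∈ Finset.range n, d' k x = ∑ k, d k x := by
        rw [← Fin.sum_univ_eq_sum_range fun k => d' k x]
        exact Finset.sum_congr rfl fun k _ => by rw [hd'_lt k.2]
      have hsqrt : √(M ^ 2 / n) = M / √n := by rw [Real.sqrt_div' _ n.cast_nonneg, Real.sqrt_sq hM.le]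
      have hterm (ε : Fin n → Bool) :
          |∑ k, (if ε k then (1 : ℝ) else -1) * (M / √n)| ^ p =
            M ^ p * |∑ k, (if ε k then (1 : ℝ) else -1) / √n| ^ p := by
        rw [← Real.mul_rpow hM.le (abs_nonneg _), ← abs_of_pos hM, ← abs_mul, abs_of_pos hM,
          Finset.mul_sum]
        congr 3
        ext k
        ring
      simp only [hsum, rademacherMoment, signAverage_iterate_eq_sum, hsqrt, zero_add, hterm,
        ← Finset.mul_sum] at hmain
      rw [mul_left_comm, mul_comm] at hmain
      refine (Real.rpow_le_rpow (integral_nonneg fun x => by positivity) hmain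
        (by positivity)).trans (le_of_eq ?_)
      rw [Real.mul_rpow (by positivity) (by positivity), one_div p, Real.rpow_rpow_inv hM.le hp0.ne']
    · intro k
      by_cases h : k < n
      · exact hd'_lt h ▸ hd_meas _
      · exact hd'_ge h ▸ measurable_zero
    · intro k
      by_cases h : k < n
      · exact hd'_lt h ▸ hd_bdd _
      · exact ⟨0, fun x => by simp [hd'_ge h]⟩
    · intro k x y hxy
      by_cases h : k < n
      · rw [hd'_lt h]
        exact hd_adapted ⟨k, h⟩ _ x (he (k + 1) x) y (hxy ▸ he (k + 1) y)
      · simp [hd'_ge h]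
    · intro k i
      rw [hfib]
      by_cases h : k < n
      · rw [hd'_lt h]
        exact hd_mart ⟨k, h⟩ i
      · simp [hd'_ge h]
    · filter_upwards [hSq] with x hx
      refine le_trans (le_of_eq ?_) (hx (fun k => e k x) fun k => he k x)
      rw [← Fin.sum_univ_eq_sum_range fun k =>
        sSup ((fun y => |d' k y|) '' (e k ⁻¹' {e k x})) ^ 2]
      exact Finset.sum_congr rfl fun k _ => by rw [hfib, hd'_lt k.2]
  · rw [mul_one, PMF.integral_eq_sum, Finset.mul_sum]
    simp
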